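/- Let p and q be primes with p dividing q − 1 and let G_{q,p} = V ⋊ H be as defined. Then md(G_{q,p}) ≥ p; in fact, with e_1, …, e_p the standard basis vectors of V = F_q^p, the conjugates H^{e_1}, …, H^{e_p} form a family of p maximal subgroups of G_{q,p} in general position. -/

import Mathlib

/-- `V = F_q^p`, the `p`-dimensional vector space over the field with `q` elements. -/
abbrev Vqp (q p : ℕ) : Type := Fin p → ZMod q

/-- The permutation of `V = F_q^p` multiplying the `i`-th coordinate by the unit `c`. -/
def scalePerm (q p : ℕ) [Fact q.Prime] (c : (ZMod q)ˣ) (i : Fin p) : Equiv.Perm (Vqp q p) :=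
  Equiv.piCongrRight fun j =>
    if j = i then Equiv.mulLeft₀ (c : ZMod q) c.ne_zero else Equiv.refl _

/-- The permutation of `V = F_q^p` induced by a permutation `e` of the coordinates:
`(f_1, …, f_p) ↦ (f_{1 e⁻¹}, …, f_{p e⁻¹})`. -/
def coordPerm (q p : ℕ) (e : Equiv.Perm (Fin p)) : Equiv.Perm (Vqp q p) :=
  Equiv.arrowCongr e (Equiv.refl (ZMod q))

/-- The wreath product `H = C ≀ ⟨σ⟩` realized inside `Perm V`: the subgroup generated by the
scalings by `c` at each coordinate (which generate the base group `C^p`) together with the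
cyclic coordinate permutation `σ = (1 2 … p)`.  Here `C = ⟨c⟩` is the subgroup of order `p`
of `F_q^*`. -/
def Hqp (q p : ℕ) [Fact q.Prime] (c : (ZMod q)ˣ) : Subgroup (Equiv.Perm (Vqp q p)) :=
  Subgroup.closure (Set.range (scalePerm q p c) ∪ {coordPerm q p (finRotate p)})

/-- The group of translations of `V`, realized inside `Perm V`. -/
def Vtrans (q p : ℕ) : Subgroup (Equiv.Perm (Vqp q p)) :=
  Subgroup.closure (Set.range fun v : Vqp q p => Equiv.addLeft v)

/-- `G_{q,p} = V ⋊ H`, realized as the group of permutations of `V` of the form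
`x ↦ x^h + v` with `h ∈ H`, `v ∈ V` (the action of `V ⋊ H` on `V` is faithful). -/
def Gqp (q p : ℕ) [Fact q.Prime] (c : (ZMod q)ˣ) : Subgroup (Equiv.Perm (Vqp q p)) :=
  Vtrans q p ⊔ Hqp q p c

/-- The translation by `v ∈ V` as an element of `G_{q,p}`. -/
def transElt (q p : ℕ) [Fact q.Prime] (c : (ZMod q)ˣ) (v : Vqp q p) : ↥(Gqp q p c) :=
  ⟨Equiv.addLeft v, Subgroup.mem_sup_left (Subgroup.subset_closure (Set.mem_range_self v))⟩

/-- The conjugate `H^v = v⁻¹ H v` of `H` by the translation by `v`, as a subgroup of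
`G_{q,p}`. -/
def HconjGqp (q p : ℕ) [Fact q.Prime] (c : (ZMod q)ˣ) (v : Vqp q p) :
    Subgroup ↥(Gqp q p c) :=
  (((Hqp q p c).subgroupOf (Gqp q p c))).map
    (MulAut.conj (transElt q p c v)⁻¹).toMonoidHom

/-- A family of subgroups `H i` of `G` is in *general position* if for every index `i`,
the intersection of the `H j` with `j ≠ i` properly contains the intersection of all the
`H j`. -/
def GeneralPosition {G : Type*} [Group G] {ι : Type*} (H : ι → Subgroup G) : Prop :=
  ∀ i : ι, (⨅ j, H j) < ⨅ j ∈ ({i}ᶜ : Set ι), H j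

/-- `mdInv G` is the maximum size of a family of maximal subgroups of `G` in general
position. -/
noncomputable def mdInv (G : Type*) [Group G] : ℕ :=
  sSup {n | ∃ M : Fin n → Subgroup G, (∀ i, IsCoatom (M i)) ∧ GeneralPosition M}

section

open MulAction

variable {q p : ℕ}

lemma coordPerm_single (e : Equiv.Perm (Fin p)) (i : Fin p) (a : ZMod q) :
    coordPerm q p e (Pi.single i a) = Pi.single (e i) a := by
  ext j
  simp [coordPerm, Pi.single_apply, Equiv.symm_apply_eq]

variable [Fact q.Prime] {c : (ZMod q)ˣ}

lemma scalePerm_apply (c : (ZMod q)ˣ) (i : Fin p) (x : Vqp q p) :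
    scalePerm q p c i x = x + Pi.single i (((c : ZMod q) - 1) * x i) := by
  ext j
  rcases eq_or_ne j i with rfl | h
  · simp [scalePerm]
    ring
  · simp [scalePerm, h]

lemma scalePerm_mem_Hqp (c : (ZMod q)ˣ) (i : Fin p) : scalePerm q p c i ∈ Hqp q p c :=
  Subgroup.subset_closure (Or.inl ⟨i, rfl⟩)

lemma coordPerm_mem_Hqp (c : (ZMod q)ˣ) : coordPerm q p (finRotate p) ∈ Hqp q p c :=
  Subgroup.subset_closure (Or.inr rfl)

lemma Hqp_le_Gqp : Hqp q p c ≤ Gqp q p c := le_sup_right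

lemma map_add_of_mem_Hqp {h : Equiv.Perm (Vqp q p)} (hh : h ∈ Hqp q p c) (x y : Vqp q p) :
    h (x + y) = h x + h y := by
  unfold Hqp at hh
  induction hh using Subgroup.closure_induction generalizing x y with
  | mem g hg =>
    rcases hg with ⟨i, rfl⟩ | rfl
    · simp only [scalePerm_apply, Pi.add_apply, mul_add, Pi.single_add]
      abel
    · rfl
  | one => rfl
  | mul g k _ _ hg hk => simp [hg, hk]
  | inv g _ hg => rw [Equiv.Perm.inv_eq_iff_eq]; simp [hg]

lemma map_zero_of_mem_Hqp {h : Equiv.Perm (Vqp q p)} (hh : h ∈ Hqp q p c) : h 0 = 0 := by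
  simpa using map_add_of_mem_Hqp hh 0 0

variable (q p c) in
/-- The group of all maps `x ↦ h x + v` with `h ∈ H` and `v ∈ V`. -/
def affineHqp : Subgroup (Equiv.Perm (Vqp q p)) where
  carrier := {g | ∃ v, ∃ h ∈ Hqp q p c, ∀ x, g x = v + h x}
  one_mem' := ⟨0, 1, one_mem _, fun x => by simp⟩
  mul_mem' := by
    rintro a b ⟨v, h, hh, ha⟩ ⟨w, k, hk, hb⟩
    exact ⟨v + h w, h * k, mul_mem hh hk, fun x => by
      simp [ha, hb, map_add_of_mem_Hqp hh, add_assoc]⟩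
  inv_mem' := by
    rintro a ⟨v, h, hh, ha⟩
    refine ⟨h⁻¹ (-v), h⁻¹, inv_mem hh, fun x => ?_⟩
    rw [Equiv.Perm.inv_eq_iff_eq, ha, map_add_of_mem_Hqp hh]
    simp

lemma Gqp_le_affineHqp : Gqp q p c ≤ affineHqp q p c := by
  refine sup_le ((Subgroup.closure_le _).2 ?_) fun h hh => ⟨0, h, hh, fun x => by simp⟩
  rintro _ ⟨v, rfl⟩
  exact ⟨v, 1, one_mem _, fun x => rfl⟩

lemma mem_Hqp_iff (g : Gqp q p c) :
    (g : Equiv.Perm (Vqp q p)) ∈ Hqp q p c ↔ g • (0 : Vqp q p) = 0 := by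
  refine ⟨map_zero_of_mem_Hqp, fun hg => ?_⟩
  obtain ⟨v, h, hh, hgh⟩ := Gqp_le_affineHqp g.2
  have hv : v = 0 := by
    have h0 := hgh 0
    rw [map_zero_of_mem_Hqp hh, add_zero] at h0
    exact h0.symm.trans hg
  have : (g : Equiv.Perm (Vqp q p)) = h := by
    ext x : 1
    rw [hgh, hv, zero_add]
  rwa [this]

lemma transElt_smul (v x : Vqp q p) : transElt q p c v • x = v + x := rfl

lemma transElt_add (v w : Vqp q p) :
    transElt q p c (v + w) = transElt q p c v * transElt q p c w := by
  ext x : 2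
  exact add_assoc v w x

lemma transElt_zero : transElt q p c 0 = 1 := by
  ext x : 2
  exact zero_add x

lemma transElt_neg (v : Vqp q p) : transElt q p c (-v) = (transElt q p c v)⁻¹ := by
  rw [eq_inv_iff_mul_eq_one, ← transElt_add, neg_add_cancel, transElt_zero]

instance : IsPretransitive (Gqp q p c) (Vqp q p) :=
  ⟨fun x y => ⟨transElt q p c (y - x), by rw [transElt_smul, sub_add_cancel]⟩⟩

lemma HconjGqp_eq_stabilizer (v : Vqp q p) :
    HconjGqp q p c v = stabilizer (Gqp q p c) (-v) := by
  have h : (Hqp q p c).subgroupOf (Gqp q p c) = stabilizer (Gqp q p c) (0 : Vqp q p) := by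
    ext g
    exact mem_Hqp_iff g
  have hv : -v = (transElt q p c v)⁻¹ • (0 : Vqp q p) := by
    rw [← transElt_neg, transElt_smul, add_zero]
  rw [HconjGqp, h, hv, stabilizer_smul_eq_stabilizer_map_conj]

variable (c) in
/-- The vectors `v` whose translation lies in the subgroup `K` of `G`. -/
def translationVectors (K : Subgroup (Gqp q p c)) : AddSubgroup (Vqp q p) where
  carrier := {v | transElt q p c v ∈ K}
  zero_mem' := by simpa only [Set.mem_ofPred_eq, transElt_zero] using one_mem K
  add_mem' := fun ha hb => by
    simpa only [Set.mem_ofPred_eq, transElt_add] using mul_mem ha hb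
  neg_mem' := fun ha => by
    simpa only [Set.mem_ofPred_eq, transElt_neg] using inv_mem ha

lemma mem_translationVectors {K : Subgroup (Gqp q p c)} {v : Vqp q p} :
    v ∈ translationVectors c K ↔ transElt q p c v ∈ K := Iff.rfl

lemma apply_mem_translationVectors {K : Subgroup (Gqp q p c)}
    (hK : stabilizer (Gqp q p c) (0 : Vqp q p) ≤ K) {h : Equiv.Perm (Vqp q p)}
    (hh : h ∈ Hqp q p c) {v : Vqp q p} (hv : v ∈ translationVectors c K) :
    h v ∈ translationVectors c K := by
  have hhK : (⟨h, Hqp_le_Gqp hh⟩ : Gqp q p c) ∈ K := hK ((mem_Hqp_iff _).1 hh)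
  have : transElt q p c (h v) = ⟨h, Hqp_le_Gqp hh⟩ * transElt q p c v * ⟨h, Hqp_le_Gqp hh⟩⁻¹ := by
    rw [eq_mul_inv_iff_mul_eq]
    ext x : 2
    exact (map_add_of_mem_Hqp hh v x).symm
  rw [mem_translationVectors, this]
  exact mul_mem (mul_mem hhK hv) (inv_mem hhK)

/-- `V` is an irreducible `H`-module. -/
lemma eq_top_of_Hqp_invariant (hp : 2 ≤ p) (hc : c ≠ 1) {W : AddSubgroup (Vqp q p)}
    (hW : ∀ h ∈ Hqp q p c, ∀ v ∈ W, h v ∈ W) {w : Vqp q p} (hw : w ∈ W) (hw0 : w ≠ 0) :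
    W = ⊤ := by
  obtain ⟨i, hi⟩ := Function.ne_iff.1 hw0
  have hc' : (c : ZMod q) - 1 ≠ 0 := by
    rwa [sub_ne_zero, Ne, Units.val_eq_one]
  have hmul : ∀ a : ZMod q, Pi.single i a ∈ W := fun a => by
    have h1 : Pi.single i (((c : ZMod q) - 1) * w i) ∈ W := by
      have := W.sub_mem (hW _ (scalePerm_mem_Hqp c i) w hw) hw
      rwa [scalePerm_apply, add_sub_cancel_left] at this
    have h2 := W.nsmul_mem h1 (a / (((c : ZMod q) - 1) * w i)).val
    rwa [← Pi.single_smul, nsmul_eq_mul, ZMod.natCast_zmod_val,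
      div_mul_cancel₀ _ (mul_ne_zero hc' hi)] at h2
  have hrot : ∀ (a : ZMod q) (n : ℕ), Pi.single ((finRotate p ^ n) i) a ∈ W := fun a n => by
    induction n with
    | zero => exact hmul a
    | succ n ih =>
      rw [pow_succ', Equiv.Perm.mul_apply, ← coordPerm_single]
      exact hW _ (coordPerm_mem_Hqp c) _ ih
  have hsupp : ∀ j, finRotate p j ≠ j := fun j =>
    Equiv.Perm.mem_support.1 (support_finRotate_of_le hp ▸ Finset.mem_univ j)
  refine (AddSubgroup.eq_top_iff' _).2 fun x => ?_
  rw [← Finset.univ_sum_single x]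
  refine W.sum_mem fun j _ => ?_
  obtain ⟨n, rfl⟩ := (isCycle_finRotate_of_le hp).exists_pow_eq (hsupp i) (hsupp j)
  exact hrot _ n

lemma isCoatom_stabilizer_zero (hp : 2 ≤ p) (hc : c ≠ 1) :
    IsCoatom (stabilizer (Gqp q p c) (0 : Vqp q p)) := by
  have hdecomp : ∀ g : Gqp q p c, (transElt q p c (g • (0 : Vqp q p)))⁻¹ * g ∈
      stabilizer (Gqp q p c) (0 : Vqp q p) := fun g => by
    rw [mem_stabilizer_iff, mul_smul, ← transElt_neg, transElt_smul, neg_add_cancel]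
  constructor
  · intro h
    have h1 : transElt q p c (Pi.single ⟨0, by lia⟩ 1) ∈
        stabilizer (Gqp q p c) (0 : Vqp q p) := h ▸ Subgroup.mem_top _
    rw [mem_stabilizer_iff, transElt_smul, add_zero, Pi.single_eq_zero_iff] at h1
    exact one_ne_zero h1
  · intro K hK
    obtain ⟨g, hgK, hg⟩ := SetLike.exists_of_lt hK
    have htop : translationVectors c K = ⊤ :=
      eq_top_of_Hqp_invariant hp hc (w := g • (0 : Vqp q p))
        (fun h hh v hv => apply_mem_translationVectors hK.le hh hv)
        (mem_translationVectors.2 <| by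
          have := mul_mem hgK (inv_mem (hK.le (hdecomp g)))
          simpa using this)
        hg
    refine (Subgroup.eq_top_iff' _).2 fun k => ?_
    have hk : transElt q p c (k • (0 : Vqp q p)) ∈ K :=
      mem_translationVectors.1 (htop ▸ AddSubgroup.mem_top _)
    simpa using mul_mem hk (hK.le (hdecomp k))

lemma isCoatom_HconjGqp (hp : 2 ≤ p) (hc : c ≠ 1) (v : Vqp q p) :
    IsCoatom (HconjGqp q p c v) := by
  have : Nonempty (Fin p) := ⟨⟨0, by lia⟩⟩
  have := (isCoatom_stabilizer_iff_preprimitive (Gqp q p c) (0 : Vqp q p)).1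
    (isCoatom_stabilizer_zero hp hc)
  rw [HconjGqp_eq_stabilizer]
  exact (isCoatom_stabilizer_iff_preprimitive (Gqp q p c) (-v)).2 this

lemma generalPosition_HconjGqp_single (hc : c ≠ 1) :
    GeneralPosition (fun j : Fin p => HconjGqp q p c (Pi.single j 1)) := by
  intro i
  refine lt_of_le_of_ne (le_iInf fun j => le_iInf fun _ => iInf_le _ j) fun h => ?_
  let s : Gqp q p c := ⟨scalePerm q p c i, Hqp_le_Gqp (scalePerm_mem_Hqp c i)⟩
  have hs : ∀ x : Vqp q p, s • x = x + Pi.single i (((c : ZMod q) - 1) * x i) :=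
    scalePerm_apply c i
  have hmem : s ∈ ⨅ j ∈ ({i}ᶜ : Set (Fin p)), HconjGqp q p c (Pi.single j 1) := by
    simp only [Subgroup.mem_iInf]
    intro j hj
    have hij : i ≠ j := fun hij => hj hij.symm
    rw [HconjGqp_eq_stabilizer, mem_stabilizer_iff, hs]
    simp [hij]
  rw [← h, Subgroup.mem_iInf] at hmem
  have hi := hmem i
  rw [HconjGqp_eq_stabilizer, mem_stabilizer_iff, hs, add_eq_left, Pi.single_eq_zero_iff] at hi
  apply hc
  rw [← Units.val_eq_one, eq_comm, ← sub_eq_zero]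
  simpa using hi

lemma GeneralPosition.injective {G ι : Type*} [Group G] {H : ι → Subgroup G}
    (hH : GeneralPosition H) : Function.Injective H := by
  intro i j hij
  by_contra hne
  refine (hH i).not_ge (le_iInf fun k => ?_)
  by_cases hk : k = i
  · rw [hk, hij]
    exact iInf₂_le j fun h : j = i => hne h.symm
  · exact iInf₂_le k hk

lemma GeneralPosition.le_mdInv {G : Type*} [Group G] [Finite G] {n : ℕ}
    {M : Fin n → Subgroup G} (hM : GeneralPosition M) (hmax : ∀ i, IsCoatom (M i)) :
    n ≤ mdInv G := by
  refine le_csSup ⟨Nat.card (Subgroup G), ?_⟩ ⟨M, hmax, hM⟩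
  rintro m ⟨N, -, hN⟩
  simpa using Nat.card_le_card_of_injective N hN.injective

end

/-- Lemma 7: `md(G_{q,p}) ≥ p`; indeed the conjugates `H^{e_1}, …, H^{e_p}` of `H` by the
standard basis vectors form a family of `p` maximal subgroups of `G_{q,p}` in general
position. -/
theorem md_Gqp_ge (p q : ℕ) [Fact p.Prime] [Fact q.Prime] (hpq : p ∣ q - 1)
    (c : (ZMod q)ˣ) (hc : orderOf c = p) :
    (∀ j : Fin p, IsCoatom (HconjGqp q p c (Pi.single j 1))) ∧
    GeneralPosition (fun j : Fin p => HconjGqp q p c (Pi.single j 1)) ∧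
    p ≤ mdInv ↥(Gqp q p c) := by
  have hp : 2 ≤ p := (Fact.out : p.Prime).two_le
  have hc1 : c ≠ 1 := by
    rintro rfl
    rw [orderOf_one] at hc
    lia
  have hmax := fun j : Fin p => isCoatom_HconjGqp hp hc1 (Pi.single j 1)
  have hgen := generalPosition_HconjGqp_single (p := p) hc1
  exact ⟨hmax, hgen, hgen.le_mdInv hmax⟩
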